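/- The series ∑_{k=1}^∞ h_k^{(2)}·h_k²/k³ converges and equals -(93/8)·ζ(2)·ζ(5) + (525/32)·ζ(3)·ζ(4). -/

import Mathlib

open Finset Real

noncomputable def H (k : ℕ) : ℝ := ∑ j ∈ Finset.range k, (1 : ℝ) / ((j : ℝ) + 1)
noncomputable def H2 (k : ℕ) : ℝ := ∑ j ∈ Finset.range k, (1 : ℝ) / ((j : ℝ) + 1) ^ 2
noncomputable def H3 (k : ℕ) : ℝ := ∑ j ∈ Finset.range k, (1 : ℝ) / ((j : ℝ) + 1) ^ 3
noncomputable def h (k : ℕ) : ℝ := ∑ j ∈ Finset.range k, (1 : ℝ) / (2 * (j : ℝ) + 1)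
noncomputable def h2 (k : ℕ) : ℝ := ∑ j ∈ Finset.range k, (1 : ℝ) / (2 * (j : ℝ) + 1) ^ 2
noncomputable def h3 (k : ℕ) : ℝ := ∑ j ∈ Finset.range k, (1 : ℝ) / (2 * (j : ℝ) + 1) ^ 3
noncomputable def zeta (s : ℕ) : ℝ := ∑' n : ℕ, (1 : ℝ) / ((n : ℝ) + 1) ^ s

open Filter Topology

/-- The value `∑ 1 / (2 j + 1) ^ p`, expressed through `zeta p`. -/
noncomputable def oddZeta (p : ℕ) : ℝ := (1 - 1 / 2 ^ p) * zeta p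

lemma hasSum_of_eq {f g : ℕ → ℝ} {a b : ℝ} (hf : HasSum f a) (hfg : ∀ n, g n = f n)
    (hab : b = a) : HasSum g b := by
  rw [funext hfg, hab]
  exact hf

lemma hasSum_zeta {p : ℕ} (hp : 1 < p) :
    HasSum (fun n : ℕ => (1 : ℝ) / ((n : ℝ) + 1) ^ p) (zeta p) := by
  have h1 : Summable (fun n : ℕ => (1 : ℝ) / (n : ℝ) ^ p) :=
    Real.summable_one_div_nat_pow.mpr hp
  have h2 := (summable_nat_add_iff 1).mpr h1
  push_cast at h2
  exact h2.hasSum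

lemma hasSum_one_div_pow {p : ℕ} (hp : 1 < p) :
    HasSum (fun n : ℕ => (1 : ℝ) / (n : ℝ) ^ p) (zeta p) := by
  have h1 := hasSum_zeta hp
  rw [← hasSum_nat_add_iff' 1]
  have : p ≠ 0 := by omega
  simpa [this] using h1

lemma hasSum_oddZeta {p : ℕ} (hp : 1 < p) :
    HasSum (fun j : ℕ => (1 : ℝ) / (2 * (j : ℝ) + 1) ^ p) (oddZeta p) := by
  have h1 := hasSum_one_div_pow hp
  have hodd : Summable (fun j : ℕ => (1 : ℝ) / (2 * (j : ℝ) + 1) ^ p) := by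
    have := h1.summable.comp_injective (i := fun j : ℕ => 2 * j + 1)
      (fun a b hab => by simpa using hab)
    simpa [Function.comp_def] using this
  have heven : HasSum (fun j : ℕ => (1 : ℝ) / ((2 * j : ℕ) : ℝ) ^ p) (1 / 2 ^ p * zeta p) := by
    have := h1.mul_left (1 / 2 ^ p)
    refine hasSum_of_eq this (fun j => ?_) rfl
    push_cast
    rw [mul_pow, one_div_mul_one_div]
  have hodd' : HasSum (fun j : ℕ => (1 : ℝ) / ((2 * j + 1 : ℕ) : ℝ) ^ p)
      (∑' j : ℕ, (1 : ℝ) / (2 * (j : ℝ) + 1) ^ p) := by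
    simpa using hodd.hasSum
  have h2 := HasSum.even_add_odd (f := fun n : ℕ => (1 : ℝ) / (n : ℝ) ^ p) heven hodd'
  have h3 := h1.unique h2
  have h4 : oddZeta p = ∑' j : ℕ, (1 : ℝ) / (2 * (j : ℝ) + 1) ^ p := by
    unfold oddZeta
    linarith
  rw [h4]
  exact hodd.hasSum

lemma zeta_two_eq : zeta 2 = π ^ 2 / 6 :=
  (hasSum_one_div_pow (by norm_num)).unique hasSum_zeta_two

lemma zeta_four_eq : zeta 4 = π ^ 4 / 90 :=
  (hasSum_one_div_pow (by norm_num)).unique hasSum_zeta_four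

lemma oddZeta_two : oddZeta 2 = 3 / 4 * zeta 2 := by
  unfold oddZeta
  norm_num

lemma oddZeta_two_sq : oddZeta 2 ^ 2 = 3 / 2 * oddZeta 4 := by
  unfold oddZeta
  rw [zeta_two_eq, zeta_four_eq]
  ring

/-- Partial sums of `∑ 1 / (2 j + 1) ^ p`. -/
noncomputable def oddSum (p k : ℕ) : ℝ := ∑ j ∈ Finset.range k, (1 : ℝ) / (2 * (j : ℝ) + 1) ^ p

lemma oddSum_succ (p k : ℕ) :
    oddSum p (k + 1) = oddSum p k + 1 / (2 * (k : ℝ) + 1) ^ p :=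
  Finset.sum_range_succ _ _

lemma tendsto_oddSum {p : ℕ} (hp : 1 < p) : Tendsto (oddSum p) atTop (𝓝 (oddZeta p)) :=
  (hasSum_oddZeta hp).tendsto_sum_nat

lemma hasSum_shift_right (k : ℕ) :
    HasSum (fun j : ℕ => (1 : ℝ) / (2 * (j : ℝ) + 1 + 2 * k) ^ 4) (oddZeta 4 - oddSum 4 k) := by
  induction k with
  | zero => simpa [oddSum] using hasSum_oddZeta (p := 4) (by norm_num)
  | succ k ih =>
    have := (hasSum_nat_add_iff' 1).mpr ih
    simp only [Finset.sum_range_one] at this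
    rw [oddSum_succ]
    refine hasSum_of_eq this (fun j => ?_) ?_
    · push_cast
      ring_nf
    · push_cast
      ring_nf

lemma hasSum_shift_left (k : ℕ) :
    HasSum (fun j : ℕ => (1 : ℝ) / (2 * (j : ℝ) + 1 - 2 * k) ^ 4) (oddZeta 4 + oddSum 4 k) := by
  induction k with
  | zero => simpa [oddSum] using hasSum_oddZeta (p := 4) (by norm_num)
  | succ k ih =>
    rw [← hasSum_nat_add_iff' 1]
    simp only [Finset.sum_range_one]
    rw [oddSum_succ]
    refine hasSum_of_eq ih (fun j => ?_) ?_
    · push_cast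
      ring_nf
    · push_cast
      rw [show (2 * 0 + 1 - 2 * ((k : ℝ) + 1)) ^ 4 = (2 * (k : ℝ) + 1) ^ 4 by ring]
      ring

lemma tendsto_one_div_two_mul_add_pow (a : ℝ) {p : ℕ} (hp : p ≠ 0) :
    Tendsto (fun n : ℕ => (1 : ℝ) / (2 * (n : ℝ) + a) ^ p) atTop (𝓝 0) := by
  simp only [one_div]
  refine Tendsto.inv_tendsto_atTop ((tendsto_pow_atTop hp).comp ?_)
  exact tendsto_atTop_add_const_right _ _
    (tendsto_natCast_atTop_atTop.const_mul_atTop (by norm_num))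

lemma tendsto_symmetric_sum {p : ℕ} (hp : p ≠ 0) {c : ℝ}
    (h0 : Tendsto (fun n : ℕ => ∑ k ∈ Finset.range n,
      ((1 : ℝ) / (1 + 2 * ((k : ℝ) + 1)) ^ p + 1 / (1 - 2 * ((k : ℝ) + 1)) ^ p)) atTop
      (𝓝 (c - 1))) (j : ℕ) :
    Tendsto (fun n : ℕ => ∑ k ∈ Finset.range n,
      ((1 : ℝ) / (2 * (j : ℝ) + 1 + 2 * ((k : ℝ) + 1)) ^ p
        + 1 / (2 * (j : ℝ) + 1 - 2 * ((k : ℝ) + 1)) ^ p)) atTop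
      (𝓝 (c - 1 / (2 * (j : ℝ) + 1) ^ p)) := by
  induction j with
  | zero => simpa using h0
  | succ j ih =>
    have key : ∀ n : ℕ, ∑ k ∈ Finset.range n,
        ((1 : ℝ) / (2 * ((j + 1 : ℕ) : ℝ) + 1 + 2 * ((k : ℝ) + 1)) ^ p
          + 1 / (2 * ((j + 1 : ℕ) : ℝ) + 1 - 2 * ((k : ℝ) + 1)) ^ p)
        = ∑ k ∈ Finset.range n,
          ((1 : ℝ) / (2 * (j : ℝ) + 1 + 2 * ((k : ℝ) + 1)) ^ p
            + 1 / (2 * (j : ℝ) + 1 - 2 * ((k : ℝ) + 1)) ^ p)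
          + (1 / (2 * (n : ℝ) + (2 * (j : ℝ) + 3)) ^ p - 1 / (2 * (j : ℝ) + 3) ^ p)
          + (1 / (2 * (j : ℝ) + 1) ^ p
            - (-1) ^ p * (1 / (2 * (n : ℝ) + -(2 * (j : ℝ) + 1)) ^ p)) := by
      intro n
      induction n with
      | zero =>
        have : (1 : ℝ) / (2 * (j : ℝ) + 1) ^ p = (-1) ^ p * (1 / (-(2 * (j : ℝ) + 1)) ^ p) := by
          rw [neg_pow (2 * (j : ℝ) + 1)]
          rcases neg_one_pow_eq_or ℝ p with h | h <;> simp [h, div_neg]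
        simp only [Finset.sum_range_zero, Nat.cast_zero, mul_zero, zero_add]
        rw [← this]
        ring
      | succ n ihn =>
        rw [Finset.sum_range_succ, ihn, Finset.sum_range_succ]
        have h1 : (1 : ℝ) / (2 * (j : ℝ) + 1 - 2 * ((n : ℝ) + 1)) ^ p
            = (-1) ^ p * (1 / (2 * ((n + 1 : ℕ) : ℝ) + -(2 * (j : ℝ) + 1)) ^ p) := by
          rw [show 2 * (j : ℝ) + 1 - 2 * ((n : ℝ) + 1)
            = -(2 * ((n + 1 : ℕ) : ℝ) + -(2 * (j : ℝ) + 1)) by push_cast; ring, neg_pow]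
          rcases neg_one_pow_eq_or ℝ p with h | h <;> simp [h, div_neg]
        have h2 : (1 : ℝ) / (2 * ((j + 1 : ℕ) : ℝ) + 1 - 2 * ((n : ℝ) + 1)) ^ p
            = (-1) ^ p * (1 / (2 * (n : ℝ) + -(2 * (j : ℝ) + 1)) ^ p) := by
          rw [show 2 * ((j + 1 : ℕ) : ℝ) + 1 - 2 * ((n : ℝ) + 1)
            = -(2 * (n : ℝ) + -(2 * (j : ℝ) + 1)) by push_cast; ring, neg_pow]
          rcases neg_one_pow_eq_or ℝ p with h | h <;> simp [h, div_neg]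
        have h3 : 2 * (j : ℝ) + 1 + 2 * ((n : ℝ) + 1) = 2 * (n : ℝ) + (2 * (j : ℝ) + 3) := by ring
        have h4 : 2 * ((j + 1 : ℕ) : ℝ) + 1 + 2 * ((n : ℝ) + 1)
            = 2 * ((n + 1 : ℕ) : ℝ) + (2 * (j : ℝ) + 3) := by push_cast; ring
        rw [h1, h2, h3, h4]
        ring
    simp only [key]
    have h1 := tendsto_one_div_two_mul_add_pow (2 * (j : ℝ) + 3) hp
    have h2 := tendsto_one_div_two_mul_add_pow (-(2 * (j : ℝ) + 1)) hp
    have h3 := (ih.add (h1.sub_const (1 / (2 * (j : ℝ) + 3) ^ p))).add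
      ((h2.const_mul ((-1) ^ p)).const_sub (1 / (2 * (j : ℝ) + 1) ^ p))
    convert h3 using 2
    push_cast
    ring_nf

lemma tendsto_symmetric_sum_even {p : ℕ} (hp : 1 < p) (he : Even p) (j : ℕ) :
    Tendsto (fun n : ℕ => ∑ k ∈ Finset.range n,
      ((1 : ℝ) / (2 * (j : ℝ) + 1 + 2 * ((k : ℝ) + 1)) ^ p
        + 1 / (2 * (j : ℝ) + 1 - 2 * ((k : ℝ) + 1)) ^ p)) atTop
      (𝓝 (2 * oddZeta p - 1 / (2 * (j : ℝ) + 1) ^ p)) := by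
  refine tendsto_symmetric_sum (by omega) ?_ j
  have h1 := hasSum_oddZeta hp
  have h2 := (hasSum_nat_add_iff' 1).mpr h1
  have h3 := (h2.add h1).tendsto_sum_nat
  convert h3 using 2
  · refine Finset.sum_congr rfl fun k _ => ?_
    rw [show 1 - 2 * ((k : ℝ) + 1) = -(2 * (k : ℝ) + 1) by ring, he.neg_pow]
    push_cast
    ring_nf
  · simp
    ring

lemma tendsto_symmetric_sum_odd {p : ℕ} (ho : Odd p) (j : ℕ) :
    Tendsto (fun n : ℕ => ∑ k ∈ Finset.range n,
      ((1 : ℝ) / (2 * (j : ℝ) + 1 + 2 * ((k : ℝ) + 1)) ^ p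
        + 1 / (2 * (j : ℝ) + 1 - 2 * ((k : ℝ) + 1)) ^ p)) atTop
      (𝓝 (0 - 1 / (2 * (j : ℝ) + 1) ^ p)) := by
  refine tendsto_symmetric_sum ho.pos.ne' ?_ j
  have h1 : ∀ n : ℕ, ∑ k ∈ Finset.range n,
      ((1 : ℝ) / (1 + 2 * ((k : ℝ) + 1)) ^ p + 1 / (1 - 2 * ((k : ℝ) + 1)) ^ p)
      = 1 / (2 * (n : ℝ) + 1) ^ p - 1 := by
    intro n
    have := Finset.sum_range_sub (fun n : ℕ => (1 : ℝ) / (2 * (n : ℝ) + 1) ^ p) n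
    simp only [CharP.cast_eq_zero, mul_zero, zero_add, one_pow, div_one] at this
    rw [← this]
    refine Finset.sum_congr rfl fun k _ => ?_
    rw [show 1 - 2 * ((k : ℝ) + 1) = -(2 * (k : ℝ) + 1) by ring, ho.neg_pow, div_neg]
    push_cast
    ring_nf
  simp only [h1]
  exact (tendsto_one_div_two_mul_add_pow 1 ho.pos.ne').sub_const 1

lemma two_mul_add_one_ne (j k : ℕ) : 2 * (j : ℝ) + 1 - 2 * k ≠ 0 := by
  have : (2 * (j : ℤ) + 1 - 2 * k) ≠ 0 := by omega
  exact_mod_cast this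

lemma partial_fraction_three_four {K m : ℝ} (hK : K ≠ 0) (hm : m ≠ 0) (hv : m + 2 * K ≠ 0) :
    1 / K ^ 3 * (1 / (m + 2 * K) ^ 4) = 1 / m ^ 4 * (1 / K ^ 3) - 8 / m ^ 5 * (1 / K ^ 2)
      + 40 / m ^ 6 * (1 / K) - 8 / m ^ 3 * (1 / (m + 2 * K) ^ 4)
      - 24 / m ^ 4 * (1 / (m + 2 * K) ^ 3) - 48 / m ^ 5 * (1 / (m + 2 * K) ^ 2)
      - 80 / m ^ 6 * (1 / (m + 2 * K) ^ 1) := by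
  obtain ⟨v, hv'⟩ : ∃ v, v = m + 2 * K := ⟨_, rfl⟩
  rw [← hv'] at hv ⊢
  field_simp
  rw [hv']
  ring

lemma partial_fraction_symmetric {K m : ℝ} (hK : K ≠ 0) (hm : m ≠ 0) (hv : m + 2 * K ≠ 0)
    (hw : m - 2 * K ≠ 0) :
    1 / K ^ 3 * (1 / (m + 2 * K) ^ 4 - 1 / (m - 2 * K) ^ 4) =
      -(16 / m ^ 5) * (1 / K ^ 2)
      - 8 / m ^ 3 * (1 / (m + 2 * K) ^ 4 + 1 / (m - 2 * K) ^ 4)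
      - 24 / m ^ 4 * (1 / (m + 2 * K) ^ 3 + 1 / (m - 2 * K) ^ 3)
      - 48 / m ^ 5 * (1 / (m + 2 * K) ^ 2 + 1 / (m - 2 * K) ^ 2)
      - 80 / m ^ 6 * (1 / (m + 2 * K) ^ 1 + 1 / (m - 2 * K) ^ 1) := by
  have h1 := partial_fraction_three_four hK hm hv
  have h2 := partial_fraction_three_four (neg_ne_zero.mpr hK) hm
    (by rwa [mul_neg, ← sub_eq_add_neg])
  rw [mul_neg, ← sub_eq_add_neg] at h2
  have e1 : 1 / (-K) ^ 3 = -(1 / K ^ 3) := by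
    rw [Odd.neg_pow (by decide), div_neg]
  have e2 : 1 / (-K) = -(1 / K) := by rw [div_neg]
  rw [e1, e2, neg_sq] at h2
  linear_combination h1 + h2

lemma tendsto_column_sum (j : ℕ) :
    Tendsto (fun n : ℕ => ∑ k ∈ Finset.range n, 1 / ((k : ℝ) + 1) ^ 3 *
      (1 / (2 * (j : ℝ) + 1 + 2 * ((k : ℝ) + 1)) ^ 4
        - 1 / (2 * (j : ℝ) + 1 - 2 * ((k : ℝ) + 1)) ^ 4)) atTop
      (𝓝 (-(16 * zeta 2 + 96 * oddZeta 2) * (1 / (2 * (j : ℝ) + 1) ^ 5)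
        - 16 * oddZeta 4 * (1 / (2 * (j : ℝ) + 1) ^ 3)
        + 160 * (1 / (2 * (j : ℝ) + 1) ^ 7))) := by
  have hm : 2 * (j : ℝ) + 1 ≠ 0 := by positivity
  have key : ∀ k : ℕ, _ := fun k : ℕ => partial_fraction_symmetric (K := (k : ℝ) + 1)
    (m := 2 * (j : ℝ) + 1) (by positivity) hm (by positivity)
    (by have := two_mul_add_one_ne j (k + 1); push_cast at this; exact this)
  simp only [key, Finset.sum_sub_distrib, ← Finset.mul_sum]
  have h2 := (hasSum_zeta (p := 2) (by norm_num)).tendsto_sum_nat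
  have s4 := tendsto_symmetric_sum_even (p := 4) (by norm_num) (by decide) j
  have s2 := tendsto_symmetric_sum_even (p := 2) (by norm_num) (by decide) j
  have s3 := tendsto_symmetric_sum_odd (p := 3) (by decide) j
  have s1 := tendsto_symmetric_sum_odd (p := 1) (by decide) j
  have := ((((h2.const_mul (-(16 / (2 * (j : ℝ) + 1) ^ 5))).sub
    (s4.const_mul (8 / (2 * (j : ℝ) + 1) ^ 3))).sub
    (s3.const_mul (24 / (2 * (j : ℝ) + 1) ^ 4))).sub
    (s2.const_mul (48 / (2 * (j : ℝ) + 1) ^ 5))).sub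
    (s1.const_mul (80 / (2 * (j : ℝ) + 1) ^ 6))
  convert this using 2
  field_simp
  ring

lemma hasSum_oddSum_four_div :
    HasSum (fun k : ℕ => oddSum 4 (k + 1) / ((k : ℝ) + 1) ^ 3)
      ((8 * zeta 2 + 48 * oddZeta 2) * oddZeta 5 + 8 * oddZeta 4 * oddZeta 3 - 80 * oddZeta 7) := by
  set a : ℕ → ℕ → ℝ := fun k j => 1 / (2 * (j : ℝ) + 1 + 2 * ((k : ℝ) + 1)) ^ 4 with ha
  set b : ℕ → ℕ → ℝ := fun k j => 1 / (2 * (j : ℝ) + 1 - 2 * ((k : ℝ) + 1)) ^ 4 with hb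
  have hA : ∀ k, HasSum (a k) (oddZeta 4 - oddSum 4 (k + 1)) := fun k => by
    simpa [ha] using hasSum_shift_right (k + 1)
  have hB : ∀ k, HasSum (b k) (oddZeta 4 + oddSum 4 (k + 1)) := fun k => by
    simpa [hb] using hasSum_shift_left (k + 1)
  have ha0 : ∀ k j, 0 ≤ a k j := fun k j => by simp only [ha]; positivity
  have hb0 : ∀ k j, 0 ≤ b k j := fun k j => by
    simp only [hb]
    exact div_nonneg zero_le_one (Even.pow_nonneg (by decide) _)
  have hG : ∀ k : ℕ, HasSum (fun j => 1 / ((k : ℝ) + 1) ^ 3 * (a k j + b k j))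
      (1 / ((k : ℝ) + 1) ^ 3 * (2 * oddZeta 4)) := fun k => by
    have := ((hA k).add (hB k)).mul_left (1 / ((k : ℝ) + 1) ^ 3)
    exact hasSum_of_eq this (fun _ => rfl) (by ring)
  have hF : ∀ k : ℕ, HasSum (fun j => 1 / ((k : ℝ) + 1) ^ 3 * (a k j - b k j))
      (-2 * (oddSum 4 (k + 1) / ((k : ℝ) + 1) ^ 3)) := fun k => by
    have := ((hA k).sub (hB k)).mul_left (1 / ((k : ℝ) + 1) ^ 3)
    exact hasSum_of_eq this (fun _ => rfl) (by ring)
  have hsG : Summable (fun x : ℕ × ℕ => 1 / ((x.1 : ℝ) + 1) ^ 3 * (a x.1 x.2 + b x.1 x.2)) := by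
    rw [summable_prod_of_nonneg (fun x => mul_nonneg (by positivity)
      (add_nonneg (ha0 _ _) (hb0 _ _)))]
    refine ⟨fun k => (hG k).summable, ?_⟩
    simp only [fun k => (hG k).tsum_eq]
    exact (hasSum_zeta (p := 3) (by norm_num)).summable.mul_right _
  have hsF : Summable (fun x : ℕ × ℕ => 1 / ((x.1 : ℝ) + 1) ^ 3 * (a x.1 x.2 - b x.1 x.2)) := by
    refine Summable.of_norm_bounded hsG fun x => ?_
    rw [norm_mul, Real.norm_of_nonneg (by positivity : (0 : ℝ) ≤ 1 / ((x.1 : ℝ) + 1) ^ 3)]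
    refine mul_le_mul_of_nonneg_left ?_ (by positivity)
    rw [Real.norm_eq_abs, abs_le]
    constructor <;> linarith [ha0 x.1 x.2, hb0 x.1 x.2]
  have hcol : ∀ j : ℕ, Summable (fun k : ℕ => 1 / ((k : ℝ) + 1) ^ 3 * (a k j - b k j)) :=
    fun j => hsF.comp_injective (i := fun k : ℕ => (k, j)) fun x y hxy => by simpa using hxy
  have hcol' := fun j => tendsto_nhds_unique (hcol j).hasSum.tendsto_sum_nat (tendsto_column_sum j)
  have hswap := Summable.tsum_comm' (f := fun k j : ℕ => 1 / ((k : ℝ) + 1) ^ 3 * (a k j - b k j))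
    hsF (fun k => (hF k).summable) hcol
  have hsum : Summable (fun k : ℕ => -2 * (oddSum 4 (k + 1) / ((k : ℝ) + 1) ^ 3)) := by
    have := hsF.prod
    simpa only [fun k => (hF k).tsum_eq] using this
  have h5 := hasSum_oddZeta (p := 5) (by norm_num)
  have h3 := hasSum_oddZeta (p := 3) (by norm_num)
  have h7 := hasSum_oddZeta (p := 7) (by norm_num)
  have hval := (((h5.mul_left (-(16 * zeta 2 + 96 * oddZeta 2))).sub
    (h3.mul_left (16 * oddZeta 4))).add (h7.mul_left 160)).tsum_eq
  simp only [hcol', fun k => (hF k).tsum_eq] at hswap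
  rw [hval] at hswap
  have := hsum.hasSum.mul_left (-1 / 2)
  rw [← hswap] at this
  exact hasSum_of_eq this (fun k => by ring) (by ring)

open Polynomial in
lemma interpolation_at_zero (M : ℕ) (v : ℕ → ℝ) (hv : Function.Injective v) (hv0 : ∀ j, v j ≠ 0)
    (g : ℝ[X]) (hg : g.natDegree ≤ M) :
    g.coeff 1 + g.coeff 0 * ∑ j ∈ Finset.range M, 1 / v j =
      ∑ k ∈ Finset.range M,
        g.eval (v k) / (v k * ∏ j ∈ (Finset.range M).erase k, (1 - v k / v j)) := by
  set D : ℝ[X] := ∏ j ∈ Finset.range M, (1 - C (1 / v j) * X) with hD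
  have hDdeg : D.natDegree ≤ M := by
    refine (natDegree_prod_le _ _).trans ((Finset.sum_le_sum (g := fun _ => 1) fun j _ => ?_).trans
      (by simp))
    compute_degree
  have hD0 : ∀ n, (∏ j ∈ Finset.range n, (1 - C (1 / v j) * X)).coeff 0 = 1 := fun n => by
    rw [coeff_zero_prod]
    exact Finset.prod_eq_one fun j _ => by simp
  have hD1 : ∀ n, (∏ j ∈ Finset.range n, (1 - C (1 / v j) * X)).coeff 1
      = -∑ j ∈ Finset.range n, 1 / v j := fun n => by
    induction n with
    | zero => simp [coeff_one]
    | succ n ih =>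
      rw [Finset.prod_range_succ, mul_coeff_one, ih, hD0, Finset.sum_range_succ]
      simp [coeff_one]
  have hDv : ∀ k ∈ Finset.range M, D.eval (v k) = 0 := fun k hk => by
    rw [hD, eval_prod]
    refine Finset.prod_eq_zero hk ?_
    simp [hv0 k]
  set q : ℝ[X] := g - C (g.coeff 0) * D with hq
  have hq0 : q.coeff 0 = 0 := by rw [hq, coeff_sub, coeff_C_mul, hD, hD0, mul_one, sub_self]
  have hqr : q = q.divX * X := by
    conv_lhs => rw [← divX_mul_X_add q, hq0]
    simp
  have hqdeg : q.natDegree ≤ M :=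
    (natDegree_sub_le _ _).trans (max_le hg ((natDegree_C_mul_le _ _).trans hDdeg))
  have hrdeg : q.divX.degree < ((Finset.range M).card : WithBot ℕ) := by
    rw [Finset.card_range, degree_lt_iff_coeff_zero]
    intro m hm
    rw [coeff_divX]
    exact coeff_eq_zero_of_natDegree_lt (by omega)
  have hr0 : q.divX.eval 0 = g.coeff 1 + g.coeff 0 * ∑ j ∈ Finset.range M, 1 / v j := by
    rw [← coeff_zero_eq_eval_zero, coeff_divX, hq]
    simp only [zero_add, coeff_sub, coeff_C_mul, hD, hD1]
    ring
  have hrv : ∀ k ∈ Finset.range M, q.divX.eval (v k) = g.eval (v k) / v k := fun k hk => by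
    have : q.eval (v k) = q.divX.eval (v k) * v k := by
      conv_lhs => rw [hqr]
      simp
    rw [eq_div_iff (hv0 k), ← this, hq]
    simp [hDv k hk]
  have hL := Lagrange.eq_interpolate (s := Finset.range M) (v := v) (hv.injOn) hrdeg
  rw [← hr0, hL, Lagrange.interpolate_apply, eval_finsetSum]
  refine Finset.sum_congr rfl fun k hk => ?_
  rw [eval_mul, eval_C, hrv k hk, Lagrange.basis, eval_prod, ← div_div, div_eq_mul_inv (_ / _),
    ← Finset.prod_inv_distrib]
  congr 1
  refine Finset.prod_congr rfl fun j hj => ?_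
  have hjk : v k - v j ≠ 0 := sub_ne_zero.mpr fun e => (Finset.mem_erase.mp hj).1 (hv e).symm
  have hjk' : v j - v k ≠ 0 := by
    rw [← neg_sub]
    exact neg_ne_zero.mpr hjk
  simp only [Lagrange.basisDivisor, eval_mul, eval_C, eval_sub, eval_X]
  rw [show 1 - v k / v j = (v j - v k) / v j by rw [sub_div, div_self (hv0 j)], inv_div,
    ← neg_sub (v j) (v k), inv_neg]
  field_simp
  ring

lemma sum_odd_part (a : ℕ → ℝ) (x : ℝ) (M : ℕ) :
    ∑ i ∈ Finset.range (2 * M + 3), a i * x ^ i - ∑ i ∈ Finset.range (2 * M + 3), a i * (-x) ^ i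
      = 2 * x * ∑ i ∈ Finset.range (M + 1), a (2 * i + 1) * (x ^ 2) ^ i := by
  induction M with
  | zero =>
    simp [Finset.sum_range_succ]
    ring
  | succ M ih =>
    rw [Finset.sum_range_succ _ (M + 1), mul_add (2 * x), ← ih,
      show 2 * (M + 1) + 3 = 2 * M + 3 + 1 + 1 by ring]
    simp only [Finset.sum_range_succ _ (2 * M + 3 + 1), Finset.sum_range_succ _ (2 * M + 3)]
    have h1 : (-x) ^ (2 * M + 3) = -x ^ (2 * M + 3) := Odd.neg_pow ⟨M + 1, by ring⟩ x
    have h2 : (-x) ^ (2 * M + 3 + 1) = x ^ (2 * M + 3 + 1) := Even.neg_pow ⟨M + 2, by ring⟩ x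
    rw [h1, h2, show 2 * (M + 1) + 1 = 2 * M + 3 by ring]
    ring

open Polynomial in
lemma sum_residues_odd (M : ℕ) (p : ℝ[X]) (hp : p.natDegree ≤ 2 * M + 2) :
    p.coeff 3 + p.coeff 1 * ∑ j ∈ Finset.range M, 1 / ((j : ℝ) + 1) ^ 2 =
      ∑ k ∈ Finset.range M, (p.eval ((k : ℝ) + 1) - p.eval (-((k : ℝ) + 1))) /
        (2 * ((k : ℝ) + 1) ^ 3 *
          ∏ j ∈ (Finset.range M).erase k, (1 - ((k : ℝ) + 1) ^ 2 / ((j : ℝ) + 1) ^ 2)) := by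
  set g : ℝ[X] := ∑ i ∈ Finset.range (M + 1), monomial i (p.coeff (2 * i + 1)) with hg
  have hgdeg : g.natDegree ≤ M :=
    natDegree_sum_le_of_forall_le _ _ fun i hi =>
      (natDegree_monomial_le _).trans (by have := Finset.mem_range.mp hi; omega)
  have hcoeff : ∀ i, g.coeff i = p.coeff (2 * i + 1) := fun i => by
    rw [hg, finsetSum_coeff]
    simp only [coeff_monomial, Finset.sum_ite_eq', Finset.mem_range]
    split_ifs with hi
    · rfl
    · exact (coeff_eq_zero_of_natDegree_lt (by omega)).symm
  have hinj : Function.Injective (fun j : ℕ => ((j : ℝ) + 1) ^ 2) := fun i j hij => by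
    have h1 : (i : ℝ) + 1 = j + 1 :=
      (pow_left_inj₀ (by positivity) (by positivity) two_ne_zero).mp hij
    have h2 : (i : ℝ) = j := by linarith
    exact_mod_cast h2
  have key := interpolation_at_zero M (fun j : ℕ => ((j : ℝ) + 1) ^ 2) hinj
    (fun j => by positivity) g hgdeg
  rw [hcoeff, hcoeff] at key
  refine key.trans (Finset.sum_congr rfl fun k _ => ?_)
  have hk : (k : ℝ) + 1 ≠ 0 := by positivity
  have hev : p.eval ((k : ℝ) + 1) - p.eval (-((k : ℝ) + 1))
      = 2 * ((k : ℝ) + 1) * g.eval (((k : ℝ) + 1) ^ 2) := by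
    rw [eval_eq_sum_range' (n := 2 * M + 3) (by omega),
      eval_eq_sum_range' (n := 2 * M + 3) (by omega), sum_odd_part, hg, eval_finsetSum]
    simp only [eval_monomial]
  rw [hev, show 2 * ((k : ℝ) + 1) ^ 3 = 2 * ((k : ℝ) + 1) * ((k : ℝ) + 1) ^ 2 by ring,
    mul_assoc (2 * ((k : ℝ) + 1)),
    mul_div_mul_left _ _ (mul_ne_zero two_ne_zero hk)]

open Nat in
lemma prod_one_sub_sq_div_sq_lower (k n : ℕ) (hn : n ≤ k) :
    (∏ j ∈ Finset.range n, (1 - ((k : ℝ) + 1) ^ 2 / ((j : ℝ) + 1) ^ 2)) *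
      ((k - n)! * (k + 1)! * (n ! : ℝ) ^ 2) = (-1) ^ n * (k ! * (k + 1 + n)!) := by
  induction n with
  | zero => simp
  | succ n ih =>
    obtain ⟨e, rfl⟩ : ∃ e, k = n + 1 + e := ⟨k - (n + 1), by omega⟩
    have ih' := ih (by omega)
    rw [show n + 1 + e - n = e + 1 by omega, factorial_succ e] at ih'
    rw [Finset.prod_range_succ, show n + 1 + e - (n + 1) = e by omega, factorial_succ n,
      show n + 1 + e + 1 + (n + 1) = (n + 1 + e + 1 + n) + 1 by ring, factorial_succ (n + 1 + e + 1 + n)]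
    push_cast at ih' ⊢
    have hn : (n : ℝ) + 1 ≠ 0 := by positivity
    have he : (e : ℝ) + 1 ≠ 0 := by positivity
    have : (1 - ((n : ℝ) + 1 + e + 1) ^ 2 / ((n : ℝ) + 1) ^ 2) * ((n : ℝ) + 1) ^ 2
        = -((e : ℝ) + 1) * (n + 1 + e + 1 + n + 1) := by
      field_simp
      ring
    rw [pow_succ (-1 : ℝ) n]
    generalize (∏ j ∈ Finset.range n, (1 - ((n : ℝ) + 1 + e + 1) ^ 2 / ((j : ℝ) + 1) ^ 2)) = P
      at ih' ⊢
    generalize (1 - ((n : ℝ) + 1 + e + 1) ^ 2 / ((n : ℝ) + 1) ^ 2) = Q at this ⊢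
    linear_combination (-((n : ℝ) + 1 + e + 1 + n + 1)) * ih' +
      P * (e ! * (n + 1 + e + 1)! * (n ! : ℝ) ^ 2) * this

open Nat in
lemma prod_one_sub_sq_div_sq (k d : ℕ) :
    (∏ j ∈ (Finset.range (k + 1 + d)).erase k, (1 - ((k : ℝ) + 1) ^ 2 / ((j : ℝ) + 1) ^ 2)) *
      (2 * ((k + 1 + d)! : ℝ) ^ 2) = (-1) ^ k * (d ! * (2 * (k + 1) + d)!) := by
  induction d with
  | zero =>
    have h1 := prod_one_sub_sq_div_sq_lower k k le_rfl
    have h2 : (Finset.range (k + 1)).erase k = Finset.range k := by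
      rw [Finset.range_add_one, Finset.erase_insert (by simp)]
    rw [add_zero, h2, add_zero, show 2 * (k + 1) = (k + 1 + k) + 1 by ring,
      factorial_succ (k + 1 + k)]
    rw [Nat.sub_self, factorial_succ k] at h1
    rw [factorial_succ k]
    push_cast at h1 ⊢
    have hk : (k ! : ℝ) ≠ 0 := by positivity
    simp only [factorial_zero, Nat.cast_one] at h1 ⊢
    generalize (∏ j ∈ Finset.range k, (1 - ((k : ℝ) + 1) ^ 2 / ((j : ℝ) + 1) ^ 2)) = P at h1 ⊢
    have h3 : P * (((k : ℝ) + 1) * (k ! : ℝ) ^ 2) = (-1) ^ k * (k + 1 + k)! := by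
      refine mul_left_cancel₀ hk ?_
      linear_combination h1
    linear_combination 2 * ((k : ℝ) + 1) * h3
  | succ d ih =>
    have h2 : (Finset.range (k + 1 + (d + 1))).erase k
        = insert (k + 1 + d) ((Finset.range (k + 1 + d)).erase k) := by
      rw [← add_assoc, Finset.range_add_one, Finset.erase_insert_of_ne (by omega)]
    rw [h2, Finset.prod_insert (by simp), ← add_assoc (k + 1), ← add_assoc (2 * (k + 1)),
      factorial_succ (k + 1 + d), factorial_succ d, factorial_succ (2 * (k + 1) + d)]
    push_cast at ih ⊢
    have hn : (k : ℝ) + 1 + d + 1 ≠ 0 := by positivity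
    have : (1 - ((k : ℝ) + 1) ^ 2 / ((k : ℝ) + 1 + d + 1) ^ 2) * ((k : ℝ) + 1 + d + 1) ^ 2
        = ((d : ℝ) + 1) * (2 * (k + 1) + d + 1) := by
      field_simp
      ring
    generalize (∏ j ∈ (Finset.range (k + 1 + d)).erase k,
      (1 - ((k : ℝ) + 1) ^ 2 / ((j : ℝ) + 1) ^ 2)) = P at ih ⊢
    generalize (1 - ((k : ℝ) + 1) ^ 2 / ((k : ℝ) + 1 + d + 1) ^ 2) = Q at this ⊢
    linear_combination ((d : ℝ) + 1) * (2 * (k + 1) + d + 1) * ih +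
      P * (2 * ((k + 1 + d)! : ℝ) ^ 2) * this

/-- The geometric power series `∑ a ^ n X ^ n`. -/
noncomputable def geomSeries (a : ℝ) : PowerSeries ℝ := PowerSeries.mk fun n => a ^ n

section PowerSeriesLemmas

open PowerSeries

lemma coeff_geomSeries (a : ℝ) (n : ℕ) : coeff n (geomSeries a) = a ^ n := coeff_mk _ _

lemma constantCoeff_geomSeries (a : ℝ) : constantCoeff (geomSeries a) = 1 := by
  rw [← coeff_zero_eq_constantCoeff_apply, coeff_geomSeries, pow_zero]

lemma coeff_mul_one_add_C_mul_X (f : PowerSeries ℝ) (a : ℝ) (n : ℕ) :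
    coeff (n + 1) (f * (1 + C a * X)) = coeff (n + 1) f + a * coeff n f := by
  rw [mul_add, mul_one, map_add, ← mul_assoc, coeff_succ_mul_X, coeff_mul_C, mul_comm a]

lemma geomSeries_mul (a : ℝ) : geomSeries a * (1 - C a * X) = 1 := by
  ext n
  rw [show (1 : PowerSeries ℝ) - C a * X = 1 + C (-a) * X by rw [map_neg]; ring]
  cases n with
  | zero => simp [constantCoeff_geomSeries]
  | succ n =>
    rw [coeff_mul_one_add_C_mul_X, coeff_geomSeries, coeff_geomSeries, coeff_one]
    simp [pow_succ]
    ring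

lemma eq_mul_geomSeries_of_mul_eq {A B : PowerSeries ℝ} {c : ℝ} (hc : c ≠ 0)
    (hAB : A * (C c - X) = B) : A = B * (C c⁻¹ * geomSeries c⁻¹) := by
  have h1 : (C c - X) * (C c⁻¹ * geomSeries c⁻¹) = 1 := by
    have h2 : (C c : PowerSeries ℝ) * C c⁻¹ = 1 := by
      rw [← map_mul, mul_inv_cancel₀ hc, map_one]
    linear_combination geomSeries_mul c⁻¹ + geomSeries c⁻¹ * h2
  rw [← hAB, mul_assoc, h1, mul_one]

lemma C_sub_X_eq {c : ℝ} (hc : c ≠ 0) :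
    (C c - X : PowerSeries ℝ) = C c * (1 - C c⁻¹ * X) := by
  have h2 : (C c : PowerSeries ℝ) * C c⁻¹ = 1 := by
    rw [← map_mul, mul_inv_cancel₀ hc, map_one]
  linear_combination X * h2

/-- The product of `1 - 2 y / (2 j + 1 - X)` over `j < N`. -/
noncomputable def shiftProd (N : ℕ) (y : ℝ) : PowerSeries ℝ :=
  ∏ j ∈ Finset.range N,
    (1 - C (y * (2 / (2 * (j : ℝ) + 1))) * geomSeries (2 * (j : ℝ) + 1)⁻¹)

lemma shiftProd_eq (N : ℕ) (y : ℝ) :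
    shiftProd N y = (∏ j ∈ Finset.range N, C (2 * (j : ℝ) + 1)⁻¹ * geomSeries (2 * (j : ℝ) + 1)⁻¹)
      * ∏ j ∈ Finset.range N, (C (2 * (j : ℝ) + 1 - 2 * y) - X) := by
  rw [← Finset.prod_mul_distrib]
  refine Finset.prod_congr rfl fun j _ => ?_
  have hj : 2 * (j : ℝ) + 1 ≠ 0 := by positivity
  have h1 : (C (y * (2 / (2 * (j : ℝ) + 1))) : PowerSeries ℝ)
      = C (2 * (j : ℝ) + 1)⁻¹ * C (2 * y) := by
    rw [← map_mul]
    congr 1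
    field_simp
  have h2 : (C (2 * (j : ℝ) + 1)⁻¹ : PowerSeries ℝ) * C (2 * (j : ℝ) + 1) = 1 := by
    rw [← map_mul, inv_mul_cancel₀ hj, map_one]
  rw [h1, map_sub]
  linear_combination (-geomSeries (2 * (j : ℝ) + 1)⁻¹) * h2
    - geomSeries_mul (2 * (j : ℝ) + 1)⁻¹

lemma shiftProd_add_one (N : ℕ) (y : ℝ) :
    shiftProd N (y + 1) * (C (2 * (N : ℝ) - 1 - 2 * y) - X)
      = shiftProd N y * (C (-(2 * y + 1)) - X) := by
  rw [shiftProd_eq, shiftProd_eq, mul_assoc, mul_assoc]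
  congr 1
  have h1 := Finset.prod_range_succ
    (fun j : ℕ => (C (2 * (j : ℝ) + 1 - 2 * (y + 1)) - X : PowerSeries ℝ)) N
  have h2 := Finset.prod_range_succ'
    (fun j : ℕ => (C (2 * (j : ℝ) + 1 - 2 * (y + 1)) - X : PowerSeries ℝ)) N
  rw [h1] at h2
  convert h2 using 4
  · ring
  · push_cast
    ring_nf
  · push_cast
    ring

lemma two_mul_sub_ne (N k : ℕ) : 2 * (N : ℝ) - 1 - 2 * k ≠ 0 := by
  have : (2 * (N : ℤ) - 1 - 2 * k) ≠ 0 := by omega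
  exact_mod_cast this

lemma shiftProd_natCast (N k : ℕ) :
    shiftProd N k = C (∏ i ∈ Finset.range k, -(2 * (i : ℝ) + 1) / (2 * (N : ℝ) - 1 - 2 * i))
      * ((∏ i ∈ Finset.range k, (1 + C (2 * (i : ℝ) + 1)⁻¹ * X))
        * ∏ i ∈ Finset.range k, geomSeries (2 * (N : ℝ) - 1 - 2 * i)⁻¹) := by
  induction k with
  | zero => simp [shiftProd]
  | succ k ih =>
    have hk : 2 * (k : ℝ) + 1 ≠ 0 := by positivity
    have h1 := eq_mul_geomSeries_of_mul_eq (two_mul_sub_ne N k) (shiftProd_add_one N k)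
    rw [Nat.cast_succ, h1, ih, C_sub_X_eq (neg_ne_zero.mpr hk), Finset.prod_range_succ,
      Finset.prod_range_succ, Finset.prod_range_succ, div_eq_mul_inv, map_mul, map_mul, inv_neg,
      map_neg (C (R := ℝ)) (2 * (k : ℝ) + 1)⁻¹]
    ring

lemma shiftProd_neg_natCast (N k : ℕ) :
    shiftProd N (-k) = C (∏ i ∈ Finset.range k, (2 * (N : ℝ) + 1 + 2 * i) / (2 * (i : ℝ) + 1))
      * ((∏ i ∈ Finset.range k, geomSeries (2 * (i : ℝ) + 1)⁻¹)
        * ∏ i ∈ Finset.range k, (1 - C (2 * (N : ℝ) + 1 + 2 * i)⁻¹ * X)) := by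
  induction k with
  | zero => simp [shiftProd]
  | succ k ih =>
    have hk : 2 * (k : ℝ) + 1 ≠ 0 := by positivity
    have h0 := shiftProd_add_one N (-(k + 1 : ℝ))
    rw [show -((k : ℝ) + 1) + 1 = -k by ring,
      show -(2 * -((k : ℝ) + 1) + 1) = 2 * k + 1 by ring,
      show 2 * (N : ℝ) - 1 - 2 * -((k : ℝ) + 1) = 2 * N + 1 + 2 * k by ring] at h0
    have h1 := eq_mul_geomSeries_of_mul_eq hk h0.symm
    rw [Nat.cast_succ, h1, ih, C_sub_X_eq (by positivity : 2 * (N : ℝ) + 1 + 2 * k ≠ 0),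
      Finset.prod_range_succ, Finset.prod_range_succ, Finset.prod_range_succ, div_eq_mul_inv,
      map_mul, map_mul]
    ring

lemma constantCoeff_shiftProd (N : ℕ) (y : ℝ) :
    constantCoeff (shiftProd N y) = ∏ j ∈ Finset.range N, (1 - y * (2 / (2 * (j : ℝ) + 1))) := by
  rw [shiftProd, map_prod]
  refine Finset.prod_congr rfl fun j _ => ?_
  rw [map_sub, map_mul, constantCoeff_geomSeries, constantCoeff_C, map_one, mul_one]

lemma prod_one_sub_natCast (N k : ℕ) :
    ∏ j ∈ Finset.range N, (1 - (k : ℝ) * (2 / (2 * (j : ℝ) + 1)))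
      = ∏ i ∈ Finset.range k, -(2 * (i : ℝ) + 1) / (2 * (N : ℝ) - 1 - 2 * i) := by
  rw [← constantCoeff_shiftProd, shiftProd_natCast, map_mul, map_mul, constantCoeff_C, map_prod,
    map_prod]
  simp [constantCoeff_geomSeries]

lemma prod_one_add_natCast (N k : ℕ) :
    ∏ j ∈ Finset.range N, (1 - -(k : ℝ) * (2 / (2 * (j : ℝ) + 1)))
      = ∏ i ∈ Finset.range k, (2 * (N : ℝ) + 1 + 2 * i) / (2 * (i : ℝ) + 1) := by
  rw [← constantCoeff_shiftProd, shiftProd_neg_natCast, map_mul, map_mul, constantCoeff_C, map_prod,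
    map_prod]
  simp [constantCoeff_geomSeries]

end PowerSeriesLemmas

section KernelPolynomial

open Polynomial

lemma coeff_mul_one_add_C_mul_X' {A : Type*} [CommRing A] (P : A[X]) (a : A) (n : ℕ) :
    (P * (1 + C a * X)).coeff (n + 1) = P.coeff (n + 1) + a * P.coeff n := by
  rw [mul_add, mul_one, coeff_add, ← mul_assoc, coeff_mul_X, coeff_mul_C, mul_comm a]

lemma coeff_prod_one_add_mul_one_sub {A : Type*} [CommRing A] (b c : ℕ → A) (n : ℕ) :
    (∏ j ∈ Finset.range n, ((1 + C (b j) * X) * (1 + C (-c j) * X))).coeff 0 = 1 ∧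
    (∏ j ∈ Finset.range n, ((1 + C (b j) * X) * (1 + C (-c j) * X))).coeff 1
      = ∑ j ∈ Finset.range n, (b j - c j) ∧
    2 * (∏ j ∈ Finset.range n, ((1 + C (b j) * X) * (1 + C (-c j) * X))).coeff 2
      = (∑ j ∈ Finset.range n, (b j - c j)) ^ 2 - ∑ j ∈ Finset.range n, (b j ^ 2 + c j ^ 2) ∧
    6 * (∏ j ∈ Finset.range n, ((1 + C (b j) * X) * (1 + C (-c j) * X))).coeff 3
      = (∑ j ∈ Finset.range n, (b j - c j)) ^ 3
        - 3 * (∑ j ∈ Finset.range n, (b j - c j)) * (∑ j ∈ Finset.range n, (b j ^ 2 + c j ^ 2))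
        + 2 * ∑ j ∈ Finset.range n, (b j ^ 3 - c j ^ 3) := by
  induction n with
  | zero => simp [coeff_one]
  | succ n ih =>
    obtain ⟨h0, h1, h2, h3⟩ := ih
    simp only [Finset.prod_range_succ, Finset.sum_range_succ, ← mul_assoc]
    generalize (∏ j ∈ Finset.range n, (1 + C (b j) * X) * (1 + C (-c j) * X)) = P at *
    generalize (∑ j ∈ Finset.range n, (b j - c j)) = s at *
    generalize (∑ j ∈ Finset.range n, (b j ^ 2 + c j ^ 2)) = t at *
    generalize (∑ j ∈ Finset.range n, (b j ^ 3 - c j ^ 3)) = u at *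
    have e0 : (P * (1 + C (b n) * X)).coeff 0 = P.coeff 0 := by simp [mul_coeff_zero]
    have e1 := fun i => coeff_mul_one_add_C_mul_X' P (b n) i
    have e2 := fun i => coeff_mul_one_add_C_mul_X' (P * (1 + C (b n) * X)) (-c n) i
    refine ⟨by simp [mul_coeff_zero, h0], ?_, ?_, ?_⟩
    · rw [e2 0, e1 0, e0, h0, zero_add, h1]
      ring
    · rw [e2 1, e1 1, e1 0, h0, zero_add, h1]
      norm_num only
      linear_combination h2
    · rw [e2 2, e1 2, e1 1, h1]
      norm_num only
      linear_combination h3 + 3 * (b n - c n) * h2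

/-- A polynomial truncation of `1 / (Γ (1 / 2 + s) Γ ((1 - X) / 2 - s))`, normalised at `s = 0`. -/
noncomputable def kernelPoly (N : ℕ) : (PowerSeries ℝ)[X] :=
  ∏ j ∈ Finset.range N, ((1 + C (PowerSeries.C (2 / (2 * (j : ℝ) + 1))) * X)
    * (1 + C (-(PowerSeries.C (2 / (2 * (j : ℝ) + 1)) * geomSeries (2 * (j : ℝ) + 1)⁻¹)) * X))

lemma natDegree_kernelPoly (N : ℕ) : (kernelPoly N).natDegree ≤ 2 * N := by
  refine (natDegree_prod_le _ _).trans ((Finset.sum_le_sum (g := fun _ => 2) fun j _ => ?_).trans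
    (by simp [mul_comm]))
  compute_degree

lemma eval_kernelPoly (N : ℕ) (y : ℝ) :
    (kernelPoly N).eval (PowerSeries.C y)
      = PowerSeries.C (∏ j ∈ Finset.range N, (1 - -y * (2 / (2 * (j : ℝ) + 1))))
        * shiftProd N y := by
  rw [kernelPoly, eval_prod, map_prod, shiftProd, ← Finset.prod_mul_distrib]
  refine Finset.prod_congr rfl fun j _ => ?_
  simp only [eval_mul, eval_add, eval_one, eval_C, eval_X, eval_neg, map_sub, map_one, map_mul, map_neg]
  ring

/-- The coefficient of `X ^ 4` in `kernelPoly`, as a real polynomial. -/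
noncomputable def kernelCoeff (M : ℕ) : ℝ[X] :=
  ∑ i ∈ Finset.range (2 * M + 3), monomial i (PowerSeries.coeff 4 ((kernelPoly (M + 1)).coeff i))

lemma natDegree_kernelCoeff (M : ℕ) : (kernelCoeff M).natDegree ≤ 2 * M + 2 :=
  natDegree_sum_le_of_forall_le _ _ fun i hi =>
    (natDegree_monomial_le _).trans (by have := Finset.mem_range.mp hi; omega)

lemma coeff_kernelCoeff (M i : ℕ) :
    (kernelCoeff M).coeff i = PowerSeries.coeff 4 ((kernelPoly (M + 1)).coeff i) := by
  rw [kernelCoeff, finsetSum_coeff]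
  simp only [coeff_monomial, Finset.sum_ite_eq', Finset.mem_range]
  split_ifs with hi
  · rfl
  · rw [coeff_eq_zero_of_natDegree_lt, map_zero]
    have := natDegree_kernelPoly (M + 1)
    omega

lemma eval_kernelCoeff (M : ℕ) (y : ℝ) :
    (kernelCoeff M).eval y = PowerSeries.coeff 4 ((kernelPoly (M + 1)).eval (PowerSeries.C y)) := by
  have := natDegree_kernelPoly (M + 1)
  rw [kernelCoeff, eval_finsetSum, eval_eq_sum_range' (n := 2 * M + 3) (by omega), map_sum]
  refine Finset.sum_congr rfl fun i _ => ?_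
  rw [eval_monomial, ← map_pow, PowerSeries.coeff_mul_C]

end KernelPolynomial

section KernelCoefficients

open PowerSeries

lemma coeff_geomSeries_sq (a : ℝ) (n : ℕ) :
    coeff n (geomSeries a ^ 2) = ((n : ℝ) + 1) * a ^ n := by
  rw [pow_two, coeff_mul, Finset.sum_congr rfl (g := fun _ => a ^ n) fun p hp => ?_]
  · rw [Finset.sum_const, Finset.Nat.card_antidiagonal, nsmul_eq_mul, Nat.cast_succ]
  · rw [coeff_geomSeries, coeff_geomSeries, ← pow_add, Finset.HasAntidiagonal.mem_antidiagonal.mp hp]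

lemma coeff_four_mul (f g : PowerSeries ℝ) :
    coeff 4 (f * g) = coeff 0 f * coeff 4 g + coeff 1 f * coeff 3 g + coeff 2 f * coeff 2 g
      + coeff 3 f * coeff 1 g + coeff 4 f * coeff 0 g := by
  rw [coeff_mul, Finset.Nat.sum_antidiagonal_eq_sum_range_succ fun i j => coeff i f * coeff j g]
  simp only [Finset.sum_range_succ, Finset.sum_range_zero, zero_add]

lemma coeff_four_geomSeries_cube (a : ℝ) : coeff 4 (geomSeries a ^ 3) = 15 * a ^ 4 := by
  rw [pow_succ, coeff_four_mul]
  simp only [coeff_geomSeries_sq, coeff_geomSeries]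
  push_cast
  ring

lemma coeff_four_cube {f : PowerSeries ℝ} (hf : coeff 0 f = 0) :
    coeff 4 (f ^ 3) = 3 * coeff 1 f ^ 2 * coeff 2 f := by
  have e (n : ℕ) := coeff_mul n f f
  have e1 : coeff 1 (f * f) = 0 := by
    rw [e, Finset.Nat.sum_antidiagonal_eq_sum_range_succ fun i j => coeff i f * coeff j f]
    simp only [Finset.sum_range_succ, Finset.sum_range_zero, zero_add, hf]
    ring
  have e2 : coeff 2 (f * f) = coeff 1 f ^ 2 := by
    rw [e, Finset.Nat.sum_antidiagonal_eq_sum_range_succ fun i j => coeff i f * coeff j f]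
    simp only [Finset.sum_range_succ, Finset.sum_range_zero, zero_add, hf]
    ring
  have e3 : coeff 3 (f * f) = 2 * (coeff 1 f * coeff 2 f) := by
    rw [e, Finset.Nat.sum_antidiagonal_eq_sum_range_succ fun i j => coeff i f * coeff j f]
    simp only [Finset.sum_range_succ, Finset.sum_range_zero, zero_add, hf]
    ring
  have e0 : coeff 0 (f * f) = 0 := by
    rw [e]
    simp [hf]
  rw [pow_succ, pow_two, coeff_four_mul, e0, e1, e2, e3, hf]
  ring

lemma coeff_sum_kernel_one (N m : ℕ) :
    coeff m (∑ j ∈ Finset.range N, ((C (2 / (2 * (j : ℝ) + 1)) : PowerSeries ℝ)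
      - C (2 / (2 * (j : ℝ) + 1)) * geomSeries (2 * (j : ℝ) + 1)⁻¹))
      = if m = 0 then 0 else -2 * oddSum (m + 1) N := by
  rw [map_sum, oddSum]
  split_ifs with hm
  · subst hm
    refine Finset.sum_eq_zero fun j _ => ?_
    simp [constantCoeff_geomSeries]
  · rw [Finset.mul_sum]
    refine Finset.sum_congr rfl fun j _ => ?_
    rw [map_sub, coeff_C, if_neg hm, coeff_C_mul, coeff_geomSeries, pow_succ, inv_pow]
    field_simp
    ring

lemma coeff_sum_kernel_two (N m : ℕ) :
    coeff m (∑ j ∈ Finset.range N, ((C (2 / (2 * (j : ℝ) + 1)) : PowerSeries ℝ) ^ 2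
      + (C (2 / (2 * (j : ℝ) + 1)) * geomSeries (2 * (j : ℝ) + 1)⁻¹) ^ 2))
      = (if m = 0 then 8 else 4 * ((m : ℝ) + 1)) * oddSum (m + 2) N := by
  rw [map_sum, oddSum, Finset.mul_sum]
  refine Finset.sum_congr rfl fun j _ => ?_
  rw [mul_pow, ← map_pow, map_add, coeff_C, coeff_C_mul, coeff_geomSeries_sq, inv_pow]
  split_ifs with hm
  · subst hm
    norm_num
    field_simp
    norm_num
  · rw [pow_add]
    field_simp
    ring

lemma coeff_four_sum_kernel_three (N : ℕ) :
    coeff 4 (∑ j ∈ Finset.range N, ((C (2 / (2 * (j : ℝ) + 1)) : PowerSeries ℝ) ^ 3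
      - (C (2 / (2 * (j : ℝ) + 1)) * geomSeries (2 * (j : ℝ) + 1)⁻¹) ^ 3))
      = -120 * oddSum 7 N := by
  rw [map_sum, oddSum, Finset.mul_sum]
  refine Finset.sum_congr rfl fun j _ => ?_
  rw [mul_pow, ← map_pow, map_sub, coeff_C, coeff_C_mul, coeff_four_geomSeries_cube, inv_pow]
  norm_num
  field_simp
  norm_num

lemma coeff_one_kernelCoeff (M : ℕ) : (kernelCoeff M).coeff 1 = -2 * oddSum 5 (M + 1) := by
  have h1 := (coeff_prod_one_add_mul_one_sub (fun j : ℕ => (C (2 / (2 * (j : ℝ) + 1)) :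
    PowerSeries ℝ)) (fun j => C (2 / (2 * (j : ℝ) + 1)) * geomSeries (2 * (j : ℝ) + 1)⁻¹)
    (M + 1)).2.1
  rw [coeff_kernelCoeff, kernelPoly, h1, coeff_sum_kernel_one]
  norm_num

lemma coeff_three_kernelCoeff (M : ℕ) : (kernelCoeff M).coeff 3
    = -4 * oddSum 2 (M + 1) ^ 2 * oddSum 3 (M + 1) + 24 * oddSum 2 (M + 1) * oddSum 5 (M + 1)
      + 20 * oddSum 3 (M + 1) * oddSum 4 (M + 1) - 40 * oddSum 7 (M + 1) := by
  have h3 := (coeff_prod_one_add_mul_one_sub (fun j : ℕ => (C (2 / (2 * (j : ℝ) + 1)) :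
    PowerSeries ℝ)) (fun j => C (2 / (2 * (j : ℝ) + 1)) * geomSeries (2 * (j : ℝ) + 1)⁻¹)
    (M + 1)).2.2.2
  rw [coeff_kernelCoeff, kernelPoly]
  generalize Polynomial.coeff (R := PowerSeries ℝ) _ 3 = Q at h3 ⊢
  have e1 := coeff_sum_kernel_one (M + 1)
  have e2 := coeff_sum_kernel_two (M + 1)
  have e3 := coeff_four_sum_kernel_three (M + 1)
  have h4 := congrArg (coeff 4) h3
  rw [show (6 : PowerSeries ℝ) = C 6 from (map_ofNat C 6).symm,
    show (3 : PowerSeries ℝ) = C 3 from (map_ofNat C 3).symm,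
    show (2 : PowerSeries ℝ) = C 2 from (map_ofNat C 2).symm, map_add, map_sub, coeff_C_mul,
    coeff_C_mul, mul_assoc (C 3), coeff_C_mul, e3, coeff_four_cube (by rw [e1, if_pos rfl]),
    coeff_four_mul] at h4
  simp only [e1, e2] at h4
  norm_num at h4
  linear_combination h4 / 6

end KernelCoefficients

section OddProducts

open PowerSeries

/-- The product of `1 + X / (2 i + 1)` over `i < k`. -/
noncomputable def oddLinear (k : ℕ) : PowerSeries ℝ :=
  ∏ i ∈ Finset.range k, (1 + C (2 * (i : ℝ) + 1)⁻¹ * X)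

/-- The product of `1 / (1 - X / (2 i + 1))` over `i < k`. -/
noncomputable def oddGeom (k : ℕ) : PowerSeries ℝ :=
  ∏ i ∈ Finset.range k, geomSeries (2 * (i : ℝ) + 1)⁻¹

lemma oddSum_one (k : ℕ) : oddSum 1 k = h k := by simp [oddSum, h]

lemma oddSum_two (k : ℕ) : oddSum 2 k = h2 k := rfl

lemma coeff_oddLinear (k : ℕ) :
    coeff 0 (oddLinear k) = 1 ∧ coeff 1 (oddLinear k) = oddSum 1 k ∧
    coeff 2 (oddLinear k) = (oddSum 1 k ^ 2 - oddSum 2 k) / 2 ∧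
    coeff 3 (oddLinear k) = (oddSum 1 k ^ 3 - 3 * oddSum 1 k * oddSum 2 k + 2 * oddSum 3 k) / 6 ∧
    coeff 4 (oddLinear k) = (oddSum 1 k ^ 4 - 6 * oddSum 1 k ^ 2 * oddSum 2 k
      + 3 * oddSum 2 k ^ 2 + 8 * oddSum 1 k * oddSum 3 k - 6 * oddSum 4 k) / 24 := by
  induction k with
  | zero => simp [oddLinear, oddSum, coeff_one]
  | succ k ih =>
    obtain ⟨h0, h1, h2, h3, h4⟩ := ih
    have e (n : ℕ) : coeff (n + 1) (oddLinear (k + 1))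
        = coeff (n + 1) (oddLinear k) + (2 * (k : ℝ) + 1)⁻¹ * coeff n (oddLinear k) := by
      rw [oddLinear, Finset.prod_range_succ, coeff_mul_one_add_C_mul_X, oddLinear]
    have e1 := e 0
    have e2 := e 1
    have e3 := e 2
    have e4 := e 3
    norm_num only at e1 e2 e3 e4
    simp only [oddSum_succ, one_div, ← inv_pow]
    rw [e1, e2, e3, e4, h0, h1, h2, h3, h4]
    refine ⟨?_, ?_, ?_, ?_, ?_⟩
    · rw [coeff_zero_eq_constantCoeff_apply] at h0 ⊢
      rw [← h0, oddLinear, Finset.prod_range_succ, map_mul]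
      simp [oddLinear]
    all_goals ring

lemma coeff_oddGeom (k : ℕ) :
    coeff 0 (oddGeom k) = 1 ∧ coeff 1 (oddGeom k) = oddSum 1 k ∧
    coeff 2 (oddGeom k) = (oddSum 1 k ^ 2 + oddSum 2 k) / 2 ∧
    coeff 3 (oddGeom k) = (oddSum 1 k ^ 3 + 3 * oddSum 1 k * oddSum 2 k + 2 * oddSum 3 k) / 6 ∧
    coeff 4 (oddGeom k) = (oddSum 1 k ^ 4 + 6 * oddSum 1 k ^ 2 * oddSum 2 k
      + 3 * oddSum 2 k ^ 2 + 8 * oddSum 1 k * oddSum 3 k + 6 * oddSum 4 k) / 24 := by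
  induction k with
  | zero => simp [oddGeom, oddSum, coeff_one]
  | succ k ih =>
    obtain ⟨h0, h1, h2, h3, h4⟩ := ih
    have e (n : ℕ) : coeff (n + 1) (oddGeom (k + 1))
        = coeff (n + 1) (oddGeom k) + (2 * (k : ℝ) + 1)⁻¹ * coeff n (oddGeom (k + 1)) := by
      have hmul : oddGeom (k + 1) * (1 + C (-(2 * (k : ℝ) + 1)⁻¹) * X) = oddGeom k := by
        rw [oddGeom, Finset.prod_range_succ, mul_assoc, map_neg, neg_mul, ← sub_eq_add_neg,
          geomSeries_mul, mul_one, oddGeom]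
      rw [← hmul, coeff_mul_one_add_C_mul_X]
      ring
    have e0 : coeff 0 (oddGeom (k + 1)) = 1 := by
      rw [coeff_zero_eq_constantCoeff_apply, oddGeom, map_prod]
      simp [constantCoeff_geomSeries]
    have e1 := e 0
    have e2 := e 1
    have e3 := e 2
    have e4 := e 3
    norm_num only at e1 e2 e3 e4
    rw [e0, h1] at e1
    rw [e1, h2] at e2
    rw [e2, h3] at e3
    rw [e3, h4] at e4
    simp only [oddSum_succ, one_div, ← inv_pow]
    rw [e0, e1, e2, e3, e4]
    refine ⟨rfl, ?_, ?_, ?_, ?_⟩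
    all_goals ring

lemma coeff_four_oddGeom_sub_oddLinear (k : ℕ) :
    coeff 4 (oddGeom k) - coeff 4 (oddLinear k) = (h2 k * h k ^ 2 + oddSum 4 k) / 2 := by
  rw [(coeff_oddGeom k).2.2.2.2, (coeff_oddLinear k).2.2.2.2, oddSum_one, oddSum_two]
  ring

/-- The product of `1 / (1 - X / (2 M + 1 - 2 i))` over `i < k`. -/
noncomputable def tailGeom (M k : ℕ) : PowerSeries ℝ :=
  ∏ i ∈ Finset.range k, geomSeries (2 * (M : ℝ) + 1 - 2 * i)⁻¹

/-- The product of `1 - X / (2 M + 3 + 2 i)` over `i < k`. -/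
noncomputable def tailLinear (M k : ℕ) : PowerSeries ℝ :=
  ∏ i ∈ Finset.range k, (1 + C (-(2 * (M : ℝ) + 3 + 2 * i)⁻¹) * X)

lemma tendsto_inv_mul_natCast_add {a : ℝ} (ha : 0 < a) (b : ℝ) :
    Tendsto (fun M : ℕ => (a * (M : ℝ) + b)⁻¹) atTop (𝓝 0) :=
  tendsto_inv_atTop_zero.comp
    (tendsto_atTop_add_const_right _ _ (tendsto_natCast_atTop_atTop.const_mul_atTop ha))

open scoped PowerSeries.WithPiTopology

lemma tendsto_tailGeom (k : ℕ) : Tendsto (fun M => tailGeom M k) atTop (𝓝 1) := by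
  rw [← Finset.prod_const_one (s := Finset.range k) (M := PowerSeries ℝ)]
  refine tendsto_finsetProd _ fun i _ => ?_
  rw [PowerSeries.WithPiTopology.tendsto_iff_coeff_tendsto]
  intro m
  have h1 := (tendsto_inv_mul_natCast_add two_pos (1 - 2 * (i : ℝ))).pow m
  rw [coeff_one]
  refine (h1.congr fun M => ?_).trans_eq ?_
  · rw [coeff_geomSeries, add_sub_assoc]
  · rw [zero_pow_eq]

lemma tendsto_tailLinear (k : ℕ) : Tendsto (fun M => tailLinear M k) atTop (𝓝 1) := by
  rw [← Finset.prod_const_one (s := Finset.range k) (M := PowerSeries ℝ)]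
  refine tendsto_finsetProd _ fun i _ => ?_
  rw [PowerSeries.WithPiTopology.tendsto_iff_coeff_tendsto]
  intro m
  have h1 := ((tendsto_inv_mul_natCast_add two_pos (3 + 2 * (i : ℝ))).neg.mul_const
    (coeff m (X : PowerSeries ℝ))).const_add (coeff m (1 : PowerSeries ℝ))
  rw [neg_zero, zero_mul, add_zero] at h1
  refine h1.congr fun M => ?_
  rw [map_add, coeff_C_mul, add_assoc]

lemma tendsto_coeff_mul_tailGeom (f : PowerSeries ℝ) (m k : ℕ) :
    Tendsto (fun M => coeff m (f * tailGeom M k)) atTop (𝓝 (coeff m f)) := by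
  have h1 := (tendsto_tailGeom k).const_mul f
  rw [mul_one] at h1
  exact (PowerSeries.WithPiTopology.tendsto_iff_coeff_tendsto _ _ _ _).mp h1 m

lemma tendsto_coeff_mul_tailLinear (f : PowerSeries ℝ) (m k : ℕ) :
    Tendsto (fun M => coeff m (f * tailLinear M k)) atTop (𝓝 (coeff m f)) := by
  have h1 := (tendsto_tailLinear k).const_mul f
  rw [mul_one] at h1
  exact (PowerSeries.WithPiTopology.tendsto_iff_coeff_tendsto _ _ _ _).mp h1 m

/-- The coefficients of `f` are bounded by those of `1 / (1 - s X)`. -/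
def IsMajorized (f : PowerSeries ℝ) (s : ℝ) : Prop := ∀ m, |coeff m f| ≤ s ^ m

lemma IsMajorized.mul {f g : PowerSeries ℝ} {s t : ℝ} (hs : 0 ≤ s) (ht : 0 ≤ t)
    (hf : IsMajorized f s) (hg : IsMajorized g t) : IsMajorized (f * g) (s + t) := by
  intro m
  rw [coeff_mul, (Commute.all s t).add_pow']
  refine (Finset.abs_sum_le_sum_abs _ _).trans (Finset.sum_le_sum fun p hp => ?_)
  have hp' := Finset.HasAntidiagonal.mem_antidiagonal.mp hp
  have h1 : 0 ≤ s ^ p.1 * t ^ p.2 := by positivity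
  have h2 : (1 : ℝ) ≤ m.choose p.1 := by
    exact_mod_cast Nat.choose_pos (by omega : p.1 ≤ m)
  rw [abs_mul, nsmul_eq_mul]
  calc |coeff p.1 f| * |coeff p.2 g| ≤ s ^ p.1 * t ^ p.2 :=
        mul_le_mul (hf _) (hg _) (abs_nonneg _) (by positivity)
    _ ≤ m.choose p.1 * (s ^ p.1 * t ^ p.2) := le_mul_of_one_le_left h1 h2

lemma IsMajorized.prod {f : ℕ → PowerSeries ℝ} {s : ℕ → ℝ} {k : ℕ}
    (hs : ∀ i ∈ Finset.range k, 0 ≤ s i) (hf : ∀ i ∈ Finset.range k, IsMajorized (f i) (s i)) :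
    IsMajorized (∏ i ∈ Finset.range k, f i) (∑ i ∈ Finset.range k, s i) := by
  induction k with
  | zero =>
    intro m
    rw [Finset.prod_range_zero, Finset.sum_range_zero, coeff_one, zero_pow_eq]
    split_ifs <;> simp
  | succ k ih =>
    rw [Finset.prod_range_succ, Finset.sum_range_succ]
    have hsub : ∀ i ∈ Finset.range k, i ∈ Finset.range (k + 1) := fun i hi =>
      Finset.mem_range.mpr ((Finset.mem_range.mp hi).trans k.lt_succ_self)
    exact (ih (fun i hi => hs i (hsub i hi)) fun i hi => hf i (hsub i hi)).mul
      (Finset.sum_nonneg fun i hi => hs i (hsub i hi)) (hs k (Finset.self_mem_range_succ k))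
      (hf k (Finset.self_mem_range_succ k))

lemma isMajorized_geomSeries {a s : ℝ} (h : |a| ≤ s) : IsMajorized (geomSeries a) s := fun m => by
  rw [coeff_geomSeries, abs_pow]
  exact pow_le_pow_left₀ (abs_nonneg a) h m

lemma isMajorized_one_add_C_mul_X {a s : ℝ} (h : |a| ≤ s) :
    IsMajorized (1 + C a * X) s := fun m => by
  have hs := (abs_nonneg a).trans h
  rw [map_add, coeff_C_mul, coeff_one, coeff_X]
  rcases m with _ | _ | m
  · simp
  · simpa using h
  · simpa using pow_nonneg hs (m + 1 + 1)

lemma h_nonneg (k : ℕ) : 0 ≤ h k := Finset.sum_nonneg fun j _ => by positivity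

lemma isMajorized_oddLinear (k : ℕ) : IsMajorized (oddLinear k) (h k) :=
  IsMajorized.prod (fun i _ => by positivity) fun i _ =>
    isMajorized_one_add_C_mul_X (by rw [abs_of_nonneg (by positivity), one_div])

lemma isMajorized_oddGeom (k : ℕ) : IsMajorized (oddGeom k) (h k) :=
  IsMajorized.prod (fun i _ => by positivity) fun i _ =>
    isMajorized_geomSeries (by rw [abs_of_nonneg (by positivity), one_div])

lemma isMajorized_tailLinear (M k : ℕ) : IsMajorized (tailLinear M k) (h k) :=
  IsMajorized.prod (fun i _ => by positivity) fun i _ => isMajorized_one_add_C_mul_X (by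
    rw [abs_neg, abs_of_nonneg (by positivity), one_div]
    gcongr ?_⁻¹
    have : (0 : ℝ) ≤ M := M.cast_nonneg
    linarith)

lemma isMajorized_tailGeom {M k : ℕ} (hk : k ≤ M + 1) : IsMajorized (tailGeom M k) (h k) := by
  rw [h, ← Finset.sum_range_reflect]
  refine IsMajorized.prod (fun i _ => by positivity) fun i hi => isMajorized_geomSeries ?_
  have hi' := Finset.mem_range.mp hi
  have h1 : ((k - 1 - i : ℕ) : ℝ) ≤ M - i := by
    rw [le_sub_iff_add_le]
    exact_mod_cast (by omega : k - 1 - i + i ≤ M)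
  have h2 : (0 : ℝ) ≤ ((k - 1 - i : ℕ) : ℝ) := Nat.cast_nonneg _
  rw [abs_of_nonneg (inv_nonneg.mpr (by linarith)), one_div]
  gcongr ?_⁻¹
  linarith

lemma abs_coeff_four_sub_le {M k : ℕ} (hk : k ≤ M + 1) :
    |coeff 4 (oddGeom k * tailLinear M k) - coeff 4 (oddLinear k * tailGeom M k)|
      ≤ 32 * h k ^ 4 := by
  have h1 := (isMajorized_oddGeom k).mul (h_nonneg k) (h_nonneg k) (isMajorized_tailLinear M k) 4
  have h2 := (isMajorized_oddLinear k).mul (h_nonneg k) (h_nonneg k) (isMajorized_tailGeom hk) 4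
  refine (abs_sub _ _).trans ((add_le_add h1 h2).trans_eq ?_)
  ring

end OddProducts

lemma h_succ_pow_four_le (k : ℕ) : h (k + 1) ^ 4 ≤ 625 * ((k : ℝ) + 1) := by
  have hpos : (0 : ℝ) < (k : ℝ) + 1 := by positivity
  have h1 : h (k + 1) ≤ (harmonic (k + 1) : ℝ) := by
    rw [h, harmonic]
    push_cast
    refine Finset.sum_le_sum fun j _ => ?_
    rw [one_div]
    gcongr ?_⁻¹
    have : (0 : ℝ) ≤ j := j.cast_nonneg
    linarith
  have h2 := harmonic_le_one_add_log (k + 1)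
  have h3 := Real.log_le_rpow_div hpos.le (ε := 1 / 4) (by norm_num)
  have h4 : (1 : ℝ) ≤ ((k : ℝ) + 1) ^ (1 / 4 : ℝ) :=
    Real.one_le_rpow (by simp) (by norm_num)
  push_cast at h2
  have h5 : h (k + 1) ≤ 5 * ((k : ℝ) + 1) ^ (1 / 4 : ℝ) := by linarith
  calc h (k + 1) ^ 4 ≤ (5 * ((k : ℝ) + 1) ^ (1 / 4 : ℝ)) ^ 4 :=
        pow_le_pow_left₀ (h_nonneg _) h5 4
    _ = 625 * ((k : ℝ) + 1) := by
        rw [mul_pow, ← Real.rpow_natCast (((k : ℝ) + 1) ^ (1 / 4 : ℝ)), ← Real.rpow_mul hpos.le]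
        norm_num

lemma summable_h_pow_four_div :
    Summable fun k : ℕ => 32 * h (k + 1) ^ 4 / ((k : ℝ) + 1) ^ 3 := by
  refine Summable.of_nonneg_of_le (fun k => ?_) (fun k => ?_)
    ((hasSum_zeta (p := 2) (by norm_num)).summable.mul_left 20000)
  · have := h_nonneg (k + 1)
    positivity
  · rw [div_le_iff₀ (by positivity)]
    refine (mul_le_mul_of_nonneg_left (h_succ_pow_four_le k) (by norm_num)).trans_eq ?_
    field_simp
    norm_num

/-- The weight `(M! ^ 2 / ((M - k - 1)! (M + k + 1)!)) * ∏ (2 M + 3 + 2 i) / (2 M + 1 - 2 i)`, with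
the product over `i ≤ k`. -/
noncomputable def weight (M k : ℕ) : ℝ :=
  ∏ i ∈ Finset.range (k + 1), ((2 * (M : ℝ) + 3 + 2 * i) / (2 * (M : ℝ) + 1 - 2 * i)
    * (((M : ℝ) - i) / ((M : ℝ) + 1 + i)))

lemma weight_eq_zero {M k : ℕ} (hk : M ≤ k) : weight M k = 0 :=
  Finset.prod_eq_zero (Finset.mem_range.mpr (Nat.lt_succ_of_le hk)) (by simp)

lemma weight_nonneg_and_le_one (M k : ℕ) : 0 ≤ weight M k ∧ weight M k ≤ 1 := by
  rcases le_or_gt M k with hk | hk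
  · rw [weight_eq_zero hk]
    norm_num
  · have hM : (0 : ℝ) ≤ M := M.cast_nonneg
    have hi (i : ℕ) (hi : i ∈ Finset.range (k + 1)) : (i : ℝ) ≤ M := by
      exact_mod_cast (by have := Finset.mem_range.mp hi; omega : i ≤ M)
    have hnn : ∀ i ∈ Finset.range (k + 1), 0 ≤ (2 * (M : ℝ) + 3 + 2 * i) / (2 * (M : ℝ) + 1 - 2 * i)
        * (((M : ℝ) - i) / ((M : ℝ) + 1 + i)) := fun i h1 => by
      have h2 := hi i h1
      have h3 : (0 : ℝ) ≤ i := i.cast_nonneg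
      exact mul_nonneg (div_nonneg (by linarith) (by linarith))
        (div_nonneg (by linarith) (by linarith))
    refine ⟨Finset.prod_nonneg hnn, Finset.prod_le_one hnn fun i h1 => ?_⟩
    have h2 := hi i h1
    have h3 : (0 : ℝ) ≤ i := i.cast_nonneg
    rw [div_mul_div_comm, div_le_one (mul_pos (by linarith) (by linarith))]
    nlinarith

lemma tendsto_weight (k : ℕ) : Tendsto (fun M => weight M k) atTop (𝓝 1) := by
  rw [← Finset.prod_const_one (s := Finset.range (k + 1)) (M := ℝ)]
  refine tendsto_finsetProd _ fun i _ => ?_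
  have h1 := ((tendsto_inv_mul_natCast_add two_pos (1 - 2 * (i : ℝ))).const_mul
    (2 + 4 * (i : ℝ))).const_add 1
  have h2 := ((tendsto_inv_mul_natCast_add one_pos (1 + (i : ℝ))).const_mul
    (-(1 + 2 * (i : ℝ)))).const_add 1
  have h3 := h1.mul h2
  rw [mul_zero, mul_zero, add_zero, mul_one] at h3
  refine h3.congr fun M => ?_
  have hM : (0 : ℝ) ≤ M := M.cast_nonneg
  have hi : (0 : ℝ) ≤ i := i.cast_nonneg
  have e1 : 2 * (M : ℝ) + 1 - 2 * i ≠ 0 := by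
    have : 2 * (M : ℤ) + 1 - 2 * i ≠ 0 := by omega
    exact_mod_cast this
  have e2 : (M : ℝ) + 1 + i ≠ 0 := by positivity
  rw [← add_sub_assoc, one_mul, ← add_assoc]
  congr 1
  · field_simp
    ring
  · field_simp
    ring

open Nat in
lemma prod_sub_div_add_mul_factorial (k d : ℕ) :
    (∏ i ∈ Finset.range k, ((((k + d : ℕ) : ℝ) - i) / (((k + d : ℕ) : ℝ) + 1 + i)))
      * ((d ! : ℝ) * ((k + d + k)! : ℝ)) = ((k + d)! : ℝ) ^ 2 := by
  suffices hgen : ∀ M K d : ℕ, M = K + d →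
      (∏ i ∈ Finset.range K, (((M : ℝ) - i) / ((M : ℝ) + 1 + i))) * ((d ! : ℝ) * ((M + K)! : ℝ))
        = (M ! : ℝ) ^ 2 from hgen _ k d rfl
  intro M K
  induction K with
  | zero => intro d hd; simp [hd, pow_two]
  | succ K ih =>
    intro d hd
    have hM : (M : ℝ) - K = d + 1 := by
      rw [hd]
      push_cast
      ring
    have hne : (M : ℝ) + 1 + K ≠ 0 := by positivity
    rw [← ih (d + 1) (by omega), Finset.prod_range_succ, hM, ← add_assoc, Nat.factorial_succ,
      Nat.factorial_succ]
    push_cast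
    field_simp
    ring

open Nat in
lemma prod_neg_div_eq_weight {M k : ℕ} (hk : k < M) :
    (∏ i ∈ Finset.range (k + 1), -((2 * (M : ℝ) + 3 + 2 * i) / (2 * (M : ℝ) + 1 - 2 * i)))
      / (2 * ∏ j ∈ (Finset.range M).erase k, (1 - ((k : ℝ) + 1) ^ 2 / ((j : ℝ) + 1) ^ 2))
      = -weight M k := by
  obtain ⟨d, rfl⟩ := Nat.exists_eq_add_of_le (Nat.succ_le_of_lt hk)
  have h1 := prod_one_sub_sq_div_sq k d
  have h2 := prod_sub_div_add_mul_factorial (k + 1) d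
  rw [weight, Finset.prod_mul_distrib, Finset.prod_neg, Finset.card_range]
  simp only [Nat.succ_eq_add_one] at h1 h2 ⊢
  rw [show k + 1 + d + (k + 1) = 2 * (k + 1) + d by ring] at h2
  generalize (∏ i ∈ Finset.range (k + 1), ((((k + 1 + d : ℕ) : ℝ) - i)
    / (((k + 1 + d : ℕ) : ℝ) + 1 + i))) = q at h2 ⊢
  generalize (∏ j ∈ (Finset.range (k + 1 + d)).erase k,
    (1 - ((k : ℝ) + 1) ^ 2 / ((j : ℝ) + 1) ^ 2)) = p at h1 ⊢
  generalize (∏ i ∈ Finset.range (k + 1), ((2 * ((k + 1 + d : ℕ) : ℝ) + 3 + 2 * i)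
    / (2 * ((k + 1 + d : ℕ) : ℝ) + 1 - 2 * i))) = w
  have f1 : ((k + 1 + d)! : ℝ) ≠ 0 := Nat.cast_ne_zero.mpr (Nat.factorial_ne_zero _)
  have f2 : (d ! : ℝ) * ((2 * (k + 1) + d)! : ℝ) ≠ 0 := mul_ne_zero
    (Nat.cast_ne_zero.mpr (Nat.factorial_ne_zero _)) (Nat.cast_ne_zero.mpr (Nat.factorial_ne_zero _))
  have hs : ((-1 : ℝ) ^ k) * (-1) ^ k = 1 := by rw [← mul_pow]; norm_num
  have hpq : 2 * p * q = (-1) ^ k := by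
    have h3 : (2 * p * q - (-1) ^ k) * (((k + 1 + d)! : ℝ) ^ 2
        * ((d ! : ℝ) * ((2 * (k + 1) + d)! : ℝ))) = 0 := by
      linear_combination (q * ((d ! : ℝ) * ((2 * (k + 1) + d)! : ℝ))) * h1
        + ((-1) ^ k * ((d ! : ℝ) * ((2 * (k + 1) + d)! : ℝ))) * h2
    have h4 := (mul_eq_zero.mp h3).resolve_right (mul_ne_zero (pow_ne_zero 2 f1) f2)
    linarith
  have hp : 2 * p ≠ 0 := fun h0 => by
    rw [h0, zero_mul] at hpq
    exact pow_ne_zero k (by norm_num) hpq.symm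
  rw [div_eq_iff hp, pow_succ]
  linear_combination w * hpq

section FiniteIdentity

open PowerSeries

/-- The `k`th term of the finite identity obtained by interpolation. -/
noncomputable def residueTerm (M k : ℕ) : ℝ :=
  weight M k / ((k : ℝ) + 1) ^ 3 * (coeff 4 (oddGeom (k + 1) * tailLinear M (k + 1))
    - coeff 4 (oddLinear (k + 1) * tailGeom M (k + 1)))

lemma eval_kernelCoeff_sub (M K : ℕ) :
    (kernelCoeff M).eval (K : ℝ) - (kernelCoeff M).eval (-(K : ℝ))
      = -(∏ i ∈ Finset.range K, -((2 * (M : ℝ) + 3 + 2 * i) / (2 * (M : ℝ) + 1 - 2 * i)))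
        * (coeff 4 (oddGeom K * tailLinear M K) - coeff 4 (oddLinear K * tailGeom M K)) := by
  have e1 : ∏ i ∈ Finset.range K, geomSeries (2 * ((M + 1 : ℕ) : ℝ) - 1 - 2 * i)⁻¹
      = tailGeom M K := Finset.prod_congr rfl fun i _ => by
    push_cast
    ring_nf
  have e2 : ∏ i ∈ Finset.range K,
      (1 - (C (2 * ((M + 1 : ℕ) : ℝ) + 1 + 2 * i)⁻¹ : PowerSeries ℝ) * X)
      = tailLinear M K := Finset.prod_congr rfl fun i _ => by
    rw [map_neg, neg_mul, ← sub_eq_add_neg]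
    push_cast
    ring_nf
  have e3 : (∏ i ∈ Finset.range K, -(2 * (i : ℝ) + 1) / (2 * ((M + 1 : ℕ) : ℝ) - 1 - 2 * i))
      * (∏ i ∈ Finset.range K, (2 * ((M + 1 : ℕ) : ℝ) + 1 + 2 * i) / (2 * (i : ℝ) + 1))
      = ∏ i ∈ Finset.range K, -((2 * (M : ℝ) + 3 + 2 * i) / (2 * (M : ℝ) + 1 - 2 * i)) := by
    rw [← Finset.prod_mul_distrib]
    refine Finset.prod_congr rfl fun i _ => ?_
    have h1 : 2 * (i : ℝ) + 1 ≠ 0 := by positivity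
    have h2 := two_mul_sub_ne (M + 1) i
    rw [show 2 * ((M + 1 : ℕ) : ℝ) - 1 - 2 * i = 2 * (M : ℝ) + 1 - 2 * i by push_cast; ring] at h2 ⊢
    rw [show 2 * ((M + 1 : ℕ) : ℝ) + 1 + 2 * i = 2 * (M : ℝ) + 3 + 2 * i by push_cast; ring]
    field_simp
  rw [eval_kernelCoeff, eval_kernelCoeff, eval_kernelPoly, eval_kernelPoly, neg_neg,
    prod_one_sub_natCast, prod_one_add_natCast, shiftProd_natCast, shiftProd_neg_natCast, e1, e2,
    coeff_C_mul, coeff_C_mul, coeff_C_mul, coeff_C_mul, ← e3, oddLinear, oddGeom]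
  ring

lemma sum_residueTerm (M : ℕ) :
    ∑ k ∈ Finset.range M, residueTerm M k
      = (kernelCoeff M).coeff 3
        + (kernelCoeff M).coeff 1 * ∑ j ∈ Finset.range M, 1 / ((j : ℝ) + 1) ^ 2 := by
  rw [sum_residues_odd M _ (natDegree_kernelCoeff M)]
  refine Finset.sum_congr rfl fun k hk => ?_
  have h1 := eval_kernelCoeff_sub M (k + 1)
  have h2 := prod_neg_div_eq_weight (Finset.mem_range.mp hk)
  push_cast at h1
  rw [h1, residueTerm, ← neg_neg (weight M k), ← h2]
  generalize (∏ j ∈ (Finset.range M).erase k, (1 - ((k : ℝ) + 1) ^ 2 / ((j : ℝ) + 1) ^ 2)) = p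
  generalize (∏ i ∈ Finset.range (k + 1),
    -((2 * (M : ℝ) + 3 + 2 * i) / (2 * (M : ℝ) + 1 - 2 * i))) = w
  simp only [div_eq_mul_inv, mul_inv]
  ring

lemma abs_residueTerm_le (M k : ℕ) :
    |residueTerm M k| ≤ 32 * h (k + 1) ^ 4 / ((k : ℝ) + 1) ^ 3 := by
  have hb : 0 ≤ 32 * h (k + 1) ^ 4 := by have := h_nonneg (k + 1); positivity
  rcases le_or_gt M k with hk | hk
  · rw [residueTerm, weight_eq_zero hk, zero_div, zero_mul, abs_zero]
    positivity
  · obtain ⟨h0, h1⟩ := weight_nonneg_and_le_one M k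
    rw [residueTerm, abs_mul, abs_div, abs_of_nonneg h0,
      abs_of_nonneg (by positivity : 0 ≤ ((k : ℝ) + 1) ^ 3), div_mul_eq_mul_div]
    exact div_le_div_of_nonneg_right ((mul_le_of_le_one_left (abs_nonneg _) h1).trans
      (abs_coeff_four_sub_le (by omega))) (by positivity)

lemma tendsto_residueTerm (k : ℕ) : Tendsto (fun M => residueTerm M k) atTop
    (𝓝 ((h2 (k + 1) * h (k + 1) ^ 2 + oddSum 4 (k + 1)) / 2 / ((k : ℝ) + 1) ^ 3)) := by
  have h1 := ((tendsto_weight k).div_const (((k : ℝ) + 1) ^ 3)).mul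
    ((tendsto_coeff_mul_tailLinear (oddGeom (k + 1)) 4 (k + 1)).sub
      (tendsto_coeff_mul_tailGeom (oddLinear (k + 1)) 4 (k + 1)))
  rwa [coeff_four_oddGeom_sub_oddLinear, one_div_mul_eq_div] at h1

end FiniteIdentity

lemma tendsto_tsum_residueTerm : Tendsto (fun M => ∑' k, residueTerm M k) atTop
    (𝓝 (-4 * oddZeta 2 ^ 2 * oddZeta 3 + 24 * oddZeta 2 * oddZeta 5 + 20 * oddZeta 3 * oddZeta 4
      - 40 * oddZeta 7 + -2 * oddZeta 5 * zeta 2)) := by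
  have ht {p : ℕ} (hp : 1 < p) : Tendsto (fun M => oddSum p (M + 1)) atTop (𝓝 (oddZeta p)) :=
    (tendsto_oddSum hp).comp (tendsto_add_atTop_nat 1)
  have h2 := ht (p := 2) (by norm_num)
  have h3 := ht (p := 3) (by norm_num)
  have h4 := ht (p := 4) (by norm_num)
  have h5 := ht (p := 5) (by norm_num)
  have h7 := ht (p := 7) (by norm_num)
  have hz := (hasSum_zeta (p := 2) (by norm_num)).tendsto_sum_nat
  refine Tendsto.congr (fun M => ?_) ((((((h2.pow 2).const_mul (-4)).mul h3).add
    ((h2.const_mul 24).mul h5)).add ((h3.const_mul 20).mul h4)).sub (h7.const_mul 40) |>.add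
    ((h5.const_mul (-2)).mul hz))
  rw [tsum_eq_sum (s := Finset.range M) fun k hk => ?_, sum_residueTerm, coeff_one_kernelCoeff,
    coeff_three_kernelCoeff]
  rw [residueTerm, weight_eq_zero (not_lt.mp fun hlt => hk (Finset.mem_range.mpr hlt)), zero_div,
    zero_mul]

lemma hasSum_add_oddSum_four_div :
    HasSum (fun k : ℕ => (h2 (k + 1) * h (k + 1) ^ 2 + oddSum 4 (k + 1)) / 2 / ((k : ℝ) + 1) ^ 3)
      (-4 * oddZeta 2 ^ 2 * oddZeta 3 + 24 * oddZeta 2 * oddZeta 5 + 20 * oddZeta 3 * oddZeta 4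
        - 40 * oddZeta 7 + -2 * oddZeta 5 * zeta 2) := by
  have hlim := tendsto_tsum_of_dominated_convergence summable_h_pow_four_div tendsto_residueTerm
    (Eventually.of_forall fun M k => abs_residueTerm_le M k)
  rw [← tendsto_nhds_unique hlim tendsto_tsum_residueTerm]
  refine (Summable.of_norm_bounded summable_h_pow_four_div fun k => ?_).hasSum
  exact le_of_tendsto (tendsto_residueTerm k).abs
    (Eventually.of_forall fun M => abs_residueTerm_le M k)

theorem stmt19 :
    HasSum (fun k : ℕ => h2 (k + 1) * (h (k + 1)) ^ 2 / ((k : ℝ) + 1) ^ 3)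
      (-(93 / 8) * zeta 2 * zeta 5 + (525 / 32) * zeta 3 * zeta 4) := by
  refine hasSum_of_eq ((hasSum_add_oddSum_four_div.mul_left 2).sub hasSum_oddSum_four_div)
    (fun k => by ring) ?_
  rw [oddZeta_two_sq, oddZeta_two]
  simp only [oddZeta]
  ring
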